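/- Let u be a smooth solution of the heat equation ∂_t u − Δu = 0 on [−2,0] × ℝ^d satisfying |u(t,x)| ≤ e^{A₂|x|²} for all (t,x) ∈ [−2,0] × ℝ^d, where A₂ > 0. Then there exists a constant A₃ > 0 depending only on d and A₂ such that for every x₀ ∈ ℝ^d and every integer k ≥ 1, |∂_t^k u(0,x₀)| ≤ A₃^{k+1} k^k e^{2A₂|x₀|²}. -/

import Mathlib

open Real Set

/-- The Laplacian of `f : ℝ^d → ℝ`: sum of second partial derivatives. -/
noncomputable def Lap {d : ℕ} (f : EuclideanSpace ℝ (Fin d) → ℝ)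
    (x : EuclideanSpace ℝ (Fin d)) : ℝ :=
  ∑ i : Fin d,
    fderiv ℝ (fun y => fderiv ℝ f y (EuclideanSpace.single i 1)) x (EuclideanSpace.single i 1)

open Filter Topology
open scoped ContDiff

section DirectionalDerivative

variable {E : Type*} [NormedAddCommGroup E] [NormedSpace ℝ E]

/-- The derivative of `F` in the fixed direction `v`, as a function of the base point. -/
noncomputable def dirDeriv (v : E) (F : E → ℝ) (p : E) : ℝ := fderiv ℝ F p v

variable {U : Set E} {F G : E → ℝ} {p : E} (v w : E)

theorem ContDiffOn.dirDeriv (hU : IsOpen U) (hF : ContDiffOn ℝ ∞ F U) :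
    ContDiffOn ℝ ∞ (dirDeriv v F) U :=
  (hF.fderiv_of_isOpen hU (by norm_num)).clm_apply contDiffOn_const

theorem ContDiffOn.differentiableAt_of_isOpen (hU : IsOpen U) (hF : ContDiffOn ℝ ∞ F U)
    (hp : p ∈ U) : DifferentiableAt ℝ F p :=
  (hF.contDiffAt (hU.mem_nhds hp)).differentiableAt (by norm_num)

theorem dirDeriv_congr (hU : IsOpen U) (h : EqOn F G U) (hp : p ∈ U) :
    dirDeriv v F p = dirDeriv v G p := by
  unfold dirDeriv
  rw [(h.eventuallyEq_of_mem (hU.mem_nhds hp)).fderiv_eq]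

theorem dirDeriv_add (hF : DifferentiableAt ℝ F p) (hG : DifferentiableAt ℝ G p) :
    dirDeriv v (fun q => F q + G q) p = dirDeriv v F p + dirDeriv v G p := by
  simp [dirDeriv, fderiv_fun_add hF hG]

theorem dirDeriv_const_mul (c : ℝ) (hF : DifferentiableAt ℝ F p) :
    dirDeriv v (fun q => c * F q) p = c * dirDeriv v F p := by
  simp [dirDeriv, fderiv_const_mul hF c]

theorem dirDeriv_mul (hF : DifferentiableAt ℝ F p) (hG : DifferentiableAt ℝ G p) :
    dirDeriv v (fun q => F q * G q) p = F p * dirDeriv v G p + G p * dirDeriv v F p := by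
  simp [dirDeriv, fderiv_fun_mul hF hG]

theorem dirDeriv_sum {ι : Type*} (s : Finset ι) {f : ι → E → ℝ}
    (hf : ∀ i ∈ s, DifferentiableAt ℝ (f i) p) :
    dirDeriv v (fun q => ∑ i ∈ s, f i q) p = ∑ i ∈ s, dirDeriv v (f i) p := by
  simp [dirDeriv, fderiv_fun_sum hf]

theorem dirDeriv_dirDeriv_mul (hU : IsOpen U) (hF : ContDiffOn ℝ ∞ F U)
    (hG : ContDiffOn ℝ ∞ G U) (hp : p ∈ U) :
    dirDeriv v (dirDeriv v (fun q => F q * G q)) p =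
      F p * dirDeriv v (dirDeriv v G) p + G p * dirDeriv v (dirDeriv v F) p
        + 2 * (dirDeriv v F p * dirDeriv v G p) := by
  have hF' := hF.dirDeriv v hU
  have hG' := hG.dirDeriv v hU
  have h : EqOn (dirDeriv v (fun q => F q * G q))
      (fun q => F q * dirDeriv v G q + G q * dirDeriv v F q) U := fun q hq =>
    dirDeriv_mul v (hF.differentiableAt_of_isOpen hU hq) (hG.differentiableAt_of_isOpen hU hq)
  rw [dirDeriv_congr v hU h hp,
    dirDeriv_add v ((hF.mul hG').differentiableAt_of_isOpen hU hp)
      ((hG.mul hF').differentiableAt_of_isOpen hU hp),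
    dirDeriv_mul v (hF.differentiableAt_of_isOpen hU hp) (hG'.differentiableAt_of_isOpen hU hp),
    dirDeriv_mul v (hG.differentiableAt_of_isOpen hU hp) (hF'.differentiableAt_of_isOpen hU hp)]
  ring

theorem dirDeriv_comm (hU : IsOpen U) (hF : ContDiffOn ℝ ∞ F U) (hp : p ∈ U) :
    dirDeriv v (dirDeriv w F) p = dirDeriv w (dirDeriv v F) p := by
  have hd : DifferentiableAt ℝ (fderiv ℝ F) p :=
    ((hF.fderiv_of_isOpen (m := ∞) hU (by norm_num)).contDiffAt
      (hU.mem_nhds hp)).differentiableAt (by norm_num)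
  have key (a b : E) : dirDeriv a (dirDeriv b F) p = fderiv ℝ (fderiv ℝ F) p a b := by
    change fderiv ℝ (fun q => fderiv ℝ F q b) p a = _
    rw [fderiv_clm_apply hd (differentiableAt_const b)]
    simp
  rw [key, key]
  exact (hF.contDiffAt (hU.mem_nhds hp)).isSymmSndFDerivAt
    (by rw [minSmoothness_of_isRCLikeNormedField]; exact WithTop.coe_le_coe.2 le_top) v w

theorem hasDerivAt_dirDeriv (s : ℝ) (hF : DifferentiableAt ℝ F (p + s • v)) :
    HasDerivAt (fun s : ℝ => F (p + s • v)) (dirDeriv v F (p + s • v)) s := by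
  have h : HasDerivAt (fun s : ℝ => p + s • v) v s := by
    simpa using ((hasDerivAt_id s).smul_const v).const_add p
  exact hF.hasFDerivAt.comp_hasDerivAt s h

theorem dirDeriv_eq_of_hasDerivAt {a : ℝ} (hF : DifferentiableAt ℝ F p)
    (h : HasDerivAt (fun s : ℝ => F (p + s • v)) a 0) : dirDeriv v F p = a := by
  have := hasDerivAt_dirDeriv (F := F) (p := p) v 0 (by simpa using hF)
  simpa using this.unique h

theorem deriv_deriv_nonpos_of_isLocalMax {f : ℝ → ℝ} {x : ℝ} (hf : ContinuousAt f x)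
    (h : IsLocalMax f x) : deriv (deriv f) x ≤ 0 := by
  by_contra! hpos
  have hmin := isLocalMin_of_deriv_deriv_pos hpos h.deriv_eq_zero hf
  have hconst : f =ᶠ[𝓝 x] fun _ => f x := by
    filter_upwards [h, hmin] with y h1 h2 using le_antisymm h1 h2
  have := hconst.deriv.deriv_eq
  simp [this] at hpos

theorem dirDeriv_dirDeriv_nonpos_of_line_max (hU : IsOpen U) (hF : ContDiffOn ℝ ∞ F U)
    (hp : p ∈ U) (hmax : IsLocalMax (fun s : ℝ => F (p + s • v)) 0) :
    dirDeriv v (dirDeriv v F) p ≤ 0 := by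
  have hmem : ∀ᶠ s : ℝ in 𝓝 0, p + s • v ∈ U :=
    (by fun_prop : Continuous fun s : ℝ => p + s • v).continuousAt.eventually
      (hU.mem_nhds (by simpa using hp))
  have h1 : deriv (fun s : ℝ => F (p + s • v)) =ᶠ[𝓝 0] fun s => dirDeriv v F (p + s • v) :=
    hmem.mono fun s hs => (hasDerivAt_dirDeriv v s (hF.differentiableAt_of_isOpen hU hs)).deriv
  have h0 : p + (0 : ℝ) • v ∈ U := by simpa using hp
  have h2 := (hasDerivAt_dirDeriv v 0
    ((hF.dirDeriv v hU).differentiableAt_of_isOpen hU h0)).deriv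
  have h3 := deriv_deriv_nonpos_of_isLocalMax
    (hasDerivAt_dirDeriv v 0 (hF.differentiableAt_of_isOpen hU h0)).continuousAt hmax
  rw [h1.deriv_eq, h2] at h3
  simpa using h3

theorem dirDeriv_nonneg_of_left_max (hF : DifferentiableAt ℝ F p)
    (hmax : ∀ᶠ s : ℝ in 𝓝[<] 0, F (p + s • v) ≤ F p) : 0 ≤ dirDeriv v F p := by
  have h := hasDerivAt_dirDeriv (F := F) (p := p) v 0 (by simpa using hF)
  have h2 := (hasDerivAt_iff_tendsto_slope.1 h).mono_left (nhdsLT_le_nhdsNE 0)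
  simp only [zero_smul, add_zero] at h2
  refine ge_of_tendsto h2 ?_
  filter_upwards [hmax, self_mem_nhdsWithin] with s hs (hs0 : s < 0)
  simp only [slope, zero_smul, add_zero, vsub_eq_sub, sub_zero, smul_eq_mul]
  exact mul_nonneg_of_nonpos_of_nonpos (inv_nonpos.2 hs0.le) (sub_nonpos.2 hs)

end DirectionalDerivative

section Heat

variable {d : ℕ}

/-- The unit vector in the time direction of `ℝ × ℝ^d`. -/
noncomputable def timeDir : ℝ × EuclideanSpace ℝ (Fin d) := (1, 0)

/-- The `i`-th spatial unit vector of `ℝ × ℝ^d`. -/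
noncomputable def spaceDir (i : Fin d) : ℝ × EuclideanSpace ℝ (Fin d) :=
  (0, EuclideanSpace.single i 1)

/-- The heat operator `∂ₜ - Δ`. -/
noncomputable def heatOp (F : ℝ × EuclideanSpace ℝ (Fin d) → ℝ)
    (p : ℝ × EuclideanSpace ℝ (Fin d)) : ℝ :=
  dirDeriv timeDir F p - ∑ i, dirDeriv (spaceDir i) (dirDeriv (spaceDir i) F) p

/-- The polynomial weight whose positivity set before time `p.1` is a backward paraboloid
with tip `p` and height `r ^ 2`. -/
noncomputable def parabolicWeight (r : ℝ) (p q : ℝ × EuclideanSpace ℝ (Fin d)) : ℝ :=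
  r ^ 2 - ‖q.2 - p.2‖ ^ 2 + (q.1 - p.1)

/-- The closed backward paraboloid cut out by `parabolicWeight`. -/
def paraboloid (r : ℝ) (p : ℝ × EuclideanSpace ℝ (Fin d)) :
    Set (ℝ × EuclideanSpace ℝ (Fin d)) :=
  {q | q.1 ≤ p.1 ∧ 0 ≤ parabolicWeight r p q}

/-- The closed backward cylinder with top centre `p`, height `n r ^ 2` and radius `n r`. -/
def backwardCylinder (n r : ℝ) (p : ℝ × EuclideanSpace ℝ (Fin d)) :
    Set (ℝ × EuclideanSpace ℝ (Fin d)) :=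
  {q | q.1 ≤ p.1 ∧ p.1 - n * r ^ 2 ≤ q.1 ∧ ‖q.2 - p.2‖ ≤ n * r}

variable {U : Set (ℝ × EuclideanSpace ℝ (Fin d))} {F G : ℝ × EuclideanSpace ℝ (Fin d) → ℝ}
  {p q : ℝ × EuclideanSpace ℝ (Fin d)} {r M : ℝ}

theorem contDiff_parabolicWeight (r : ℝ) (p : ℝ × EuclideanSpace ℝ (Fin d)) :
    ContDiff ℝ ∞ (parabolicWeight r p) := by
  unfold parabolicWeight
  have : ContDiff ℝ ∞ fun q : ℝ × EuclideanSpace ℝ (Fin d) => ‖q.2 - p.2‖ ^ 2 :=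
    (contDiff_snd.sub contDiff_const).norm_sq ℝ
  exact (contDiff_const.sub this).add (contDiff_fst.sub contDiff_const)

theorem parabolicWeight_self : parabolicWeight r p p = r ^ 2 := by
  simp [parabolicWeight]

theorem self_mem_paraboloid : p ∈ paraboloid r p := by
  simp [paraboloid, parabolicWeight_self, sq_nonneg]

theorem paraboloid_subset (hr : 0 ≤ r) : paraboloid r p ⊆ backwardCylinder 1 r p := by
  rintro q ⟨h1, h2⟩
  unfold parabolicWeight at h2
  refine ⟨h1, by nlinarith [sq_nonneg ‖q.2 - p.2‖], ?_⟩
  rw [one_mul]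
  exact abs_le_of_sq_le_sq' (by linarith) hr |>.2

theorem isCompact_paraboloid (hr : 0 ≤ r) : IsCompact (paraboloid r p) := by
  have hK : IsCompact (Icc (p.1 - r ^ 2) p.1 ×ˢ Metric.closedBall p.2 r) :=
    isCompact_Icc.prod (isCompact_closedBall _ _)
  refine hK.of_isClosed_subset ?_ fun q hq => ?_
  · exact (isClosed_le continuous_fst continuous_const).inter
      (isClosed_le continuous_const (contDiff_parabolicWeight r p).continuous)
  · obtain ⟨h1, h2, h3⟩ := paraboloid_subset hr hq
    rw [one_mul] at h2 h3
    exact ⟨⟨h2, h1⟩, by rwa [mem_closedBall_iff_norm]⟩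

theorem dirDeriv_timeDir_parabolicWeight : dirDeriv timeDir (parabolicWeight r p) q = 1 := by
  refine dirDeriv_eq_of_hasDerivAt _
    ((contDiff_parabolicWeight r p).differentiable (by norm_num) q) ?_
  simp only [parabolicWeight, timeDir, Prod.snd_add, Prod.fst_add, Prod.smul_mk, smul_zero,
    add_zero, smul_eq_mul, mul_one]
  simpa using (((hasDerivAt_id (0 : ℝ)).const_add q.1).sub_const p.1).const_add
    (r ^ 2 - ‖q.2 - p.2‖ ^ 2)

theorem dirDeriv_spaceDir_parabolicWeight (i : Fin d) :
    dirDeriv (spaceDir i) (parabolicWeight r p) = fun q => -2 * (q.2 i - p.2 i) := by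
  funext q
  refine dirDeriv_eq_of_hasDerivAt _
    ((contDiff_parabolicWeight r p).differentiable (by norm_num) q) ?_
  have h : HasDerivAt (fun s : ℝ => q.2 + s • EuclideanSpace.single i (1 : ℝ) - p.2)
      (EuclideanSpace.single i (1 : ℝ)) 0 := by
    simpa using (((hasDerivAt_id (0 : ℝ)).smul_const
      (EuclideanSpace.single i (1 : ℝ))).const_add q.2).sub_const p.2
  have h2 := (h.norm_sq.const_sub (r ^ 2)).add_const (q.1 - p.1)
  simp only [parabolicWeight, spaceDir, Prod.snd_add, Prod.fst_add, Prod.smul_mk, smul_zero,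
    add_zero]
  refine h2.congr_deriv ?_
  simp [EuclideanSpace.inner_single_right]

theorem dirDeriv_dirDeriv_parabolicWeight (i : Fin d) :
    dirDeriv (spaceDir i) (dirDeriv (spaceDir i) (parabolicWeight r p)) q = -2 := by
  rw [dirDeriv_spaceDir_parabolicWeight]
  refine dirDeriv_eq_of_hasDerivAt _ (by fun_prop) ?_
  have h := (((hasDerivAt_id (0 : ℝ)).const_add (q.2 i)).sub_const (p.2 i)).const_mul (-2)
  simpa [spaceDir] using h

theorem heatOp_parabolicWeight : heatOp (parabolicWeight r p) q = 1 + 2 * d := by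
  simp only [heatOp, dirDeriv_timeDir_parabolicWeight, dirDeriv_dirDeriv_parabolicWeight]
  simp
  ring

theorem sum_sq_dirDeriv_parabolicWeight :
    ∑ i, dirDeriv (spaceDir i) (parabolicWeight r p) q ^ 2 = 4 * ‖q.2 - p.2‖ ^ 2 := by
  simp only [dirDeriv_spaceDir_parabolicWeight, EuclideanSpace.norm_sq_eq, Finset.mul_sum]
  refine Finset.sum_congr rfl fun i _ => ?_
  simp
  ring

theorem heatOp_mul (hU : IsOpen U) (hF : ContDiffOn ℝ ∞ F U) (hG : ContDiffOn ℝ ∞ G U)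
    (hp : p ∈ U) :
    heatOp (fun q => F q * G q) p = F p * heatOp G p + G p * heatOp F p
      - 2 * ∑ i, dirDeriv (spaceDir i) F p * dirDeriv (spaceDir i) G p := by
  simp only [heatOp, dirDeriv_dirDeriv_mul _ hU hF hG hp, Finset.sum_add_distrib,
    ← Finset.mul_sum,
    dirDeriv_mul _ (hF.differentiableAt_of_isOpen hU hp) (hG.differentiableAt_of_isOpen hU hp)]
  ring

theorem heatOp_add (hU : IsOpen U) (hF : ContDiffOn ℝ ∞ F U) (hG : ContDiffOn ℝ ∞ G U)
    (hp : p ∈ U) : heatOp (fun q => F q + G q) p = heatOp F p + heatOp G p := by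
  have h1 (v : ℝ × EuclideanSpace ℝ (Fin d)) :
      EqOn (dirDeriv v fun q => F q + G q) (fun q => dirDeriv v F q + dirDeriv v G q) U :=
    fun q hq => dirDeriv_add v (hF.differentiableAt_of_isOpen hU hq)
      (hG.differentiableAt_of_isOpen hU hq)
  have h2 (v : ℝ × EuclideanSpace ℝ (Fin d)) : dirDeriv v (dirDeriv v fun q => F q + G q) p =
      dirDeriv v (dirDeriv v F) p + dirDeriv v (dirDeriv v G) p := by
    rw [dirDeriv_congr v hU (h1 v) hp]
    exact dirDeriv_add v ((hF.dirDeriv v hU).differentiableAt_of_isOpen hU hp)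
      ((hG.dirDeriv v hU).differentiableAt_of_isOpen hU hp)
  simp only [heatOp, h2, h1 _ hp, Finset.sum_add_distrib]
  ring

theorem heatOp_const_mul (hU : IsOpen U) (c : ℝ) (hF : ContDiffOn ℝ ∞ F U) (hp : p ∈ U) :
    heatOp (fun q => c * F q) p = c * heatOp F p := by
  have h1 (v : ℝ × EuclideanSpace ℝ (Fin d)) :
      EqOn (dirDeriv v fun q => c * F q) (fun q => c * dirDeriv v F q) U :=
    fun q hq => dirDeriv_const_mul v c (hF.differentiableAt_of_isOpen hU hq)
  have h2 (v : ℝ × EuclideanSpace ℝ (Fin d)) : dirDeriv v (dirDeriv v fun q => c * F q) p =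
      c * dirDeriv v (dirDeriv v F) p := by
    rw [dirDeriv_congr v hU (h1 v) hp]
    exact dirDeriv_const_mul v c ((hF.dirDeriv v hU).differentiableAt_of_isOpen hU hp)
  simp only [heatOp, h2, h1 _ hp, ← Finset.mul_sum]
  ring

/-- The weak maximum principle on a backward paraboloid. -/
theorem le_of_heatOp_nonpos (hr : 0 < r) (hU : IsOpen U) (hF : ContDiffOn ℝ ∞ F U)
    (hsub : paraboloid r p ⊆ U) (hop : ∀ q ∈ paraboloid r p, heatOp F q ≤ 0)
    (hbd : ∀ q ∈ paraboloid r p, parabolicWeight r p q = 0 → F q ≤ M) : F p ≤ M := by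
  by_contra! hlt
  set ε := (F p - M) / (2 * r ^ 2) with hε
  have hε0 : 0 < ε := by have := sub_pos.2 hlt; positivity
  have hεr : ε * r ^ 2 < F p - M := by
    rw [hε]; field_simp; linarith
  set V : ℝ × EuclideanSpace ℝ (Fin d) → ℝ := fun q => F q + -ε * (q.1 - p.1) with hV
  have hVU : ContDiffOn ℝ ∞ V U := hF.add (by fun_prop)
  obtain ⟨q, hq, hmax⟩ := (isCompact_paraboloid hr.le).exists_isMaxOn ⟨p, self_mem_paraboloid⟩
    (hVU.continuousOn.mono hsub)
  have hqU := hsub hq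
  have hpq : V p ≤ V q := hmax self_mem_paraboloid
  simp only [hV, sub_self, mul_zero, add_zero] at hpq
  rcases hq.2.eq_or_lt with h0 | hpos
  · have h1 := hbd q hq h0.symm
    have h2 := (paraboloid_subset hr.le hq).2.1
    nlinarith
  have hnear : ∀ v : ℝ × EuclideanSpace ℝ (Fin d),
      ∀ᶠ s : ℝ in 𝓝 0, 0 < parabolicWeight r p (q + s • v) := fun v => by
    have hc : Continuous fun s : ℝ => parabolicWeight r p (q + s • v) :=
      (contDiff_parabolicWeight r p).continuous.comp (by fun_prop)
    exact hc.continuousAt.eventually_const_lt (by simpa using hpos)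
  have htime : 0 ≤ dirDeriv timeDir V q := by
    refine dirDeriv_nonneg_of_left_max _ (hVU.differentiableAt_of_isOpen hU hqU) ?_
    filter_upwards [nhdsWithin_le_nhds (hnear timeDir), self_mem_nhdsWithin]
      with s hs (hs0 : s < 0)
    refine hmax ⟨?_, hs.le⟩
    simp only [timeDir, Prod.fst_add, Prod.smul_mk, smul_eq_mul, mul_one]
    linarith [hq.1]
  have hspace (i : Fin d) : dirDeriv (spaceDir i) (dirDeriv (spaceDir i) F) q ≤ 0 := by
    refine dirDeriv_dirDeriv_nonpos_of_line_max _ hU hF hqU ?_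
    filter_upwards [hnear (spaceDir i)] with s hs
    have h1 : (q + s • spaceDir i).1 = q.1 := by simp [spaceDir]
    have h2 : V (q + s • spaceDir i) ≤ V q := hmax ⟨by rw [h1]; exact hq.1, hs.le⟩
    simp only [hV, h1] at h2
    simpa using h2
  have htV : dirDeriv timeDir V q = dirDeriv timeDir F q + -ε := by
    rw [hV, dirDeriv_add _ (hF.differentiableAt_of_isOpen hU hqU) (by fun_prop)]
    congr 1
    refine dirDeriv_eq_of_hasDerivAt _ (by fun_prop) ?_
    have h := (((hasDerivAt_id (0 : ℝ)).const_add q.1).sub_const p.1).const_mul (-ε)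
    simpa [timeDir] using h
  have h1 := hop q hq
  have h2 := Finset.sum_nonpos fun i (_ : i ∈ Finset.univ) => hspace i
  unfold heatOp at h1
  linarith

/-- Smooth solutions of the heat equation on an open set of space-time. -/
structure IsHeatSolution (U : Set (ℝ × EuclideanSpace ℝ (Fin d)))
    (F : ℝ × EuclideanSpace ℝ (Fin d) → ℝ) : Prop where
  contDiffOn : ContDiffOn ℝ ∞ F U
  eq : ∀ p ∈ U, dirDeriv timeDir F p = ∑ i, dirDeriv (spaceDir i) (dirDeriv (spaceDir i) F) p

theorem IsHeatSolution.dirDeriv (hU : IsOpen U) (h : IsHeatSolution U F)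
    (v : ℝ × EuclideanSpace ℝ (Fin d)) : IsHeatSolution U (dirDeriv v F) := by
  refine ⟨h.contDiffOn.dirDeriv v hU, fun p hp => ?_⟩
  rw [dirDeriv_comm _ _ hU h.contDiffOn hp, dirDeriv_congr v hU h.eq hp,
    dirDeriv_sum v _ fun i _ => ((h.contDiffOn.dirDeriv _ hU).dirDeriv _
      hU).differentiableAt_of_isOpen hU hp]
  refine Finset.sum_congr rfl fun i _ => ?_
  rw [dirDeriv_comm _ _ hU (h.contDiffOn.dirDeriv _ hU) hp]
  exact dirDeriv_congr _ hU (fun q hq => dirDeriv_comm _ _ hU h.contDiffOn hq) hp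

theorem IsHeatSolution.heatOp_eq_zero (h : IsHeatSolution U F) (hp : p ∈ U) :
    heatOp F p = 0 := sub_eq_zero.2 (h.eq p hp)

theorem heatOp_weighted_sq_le (hU : IsOpen U) (h : IsHeatSolution U G)
    (hq : q ∈ paraboloid r p) (hqU : q ∈ U) :
    heatOp (fun q => (parabolicWeight r p q * G q) * (parabolicWeight r p q * G q)) q ≤
      (26 + 4 * d) * r ^ 2 * G q ^ 2 := by
  have hη : ContDiffOn ℝ ∞ (parabolicWeight r p) U := (contDiff_parabolicWeight r p).contDiffOn
  have hηd := hη.differentiableAt_of_isOpen hU hqU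
  have hGd := h.contDiffOn.differentiableAt_of_isOpen hU hqU
  rw [heatOp_mul hU (hη.mul h.contDiffOn) (hη.mul h.contDiffOn) hqU,
    heatOp_mul hU hη h.contDiffOn hqU, h.heatOp_eq_zero hqU, heatOp_parabolicWeight]
  simp only [dirDeriv_mul _ hηd hGd]
  have hsum := sum_sq_dirDeriv_parabolicWeight (r := r) (p := p) (q := q)
  obtain ⟨hq1, hq0⟩ := hq
  have hle : parabolicWeight r p q ≤ r ^ 2 := by
    unfold parabolicWeight; nlinarith [sq_nonneg ‖q.2 - p.2‖]
  have hx : ‖q.2 - p.2‖ ^ 2 ≤ r ^ 2 := by unfold parabolicWeight at hq0; linarith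
  set η := parabolicWeight r p q
  set g := G q
  have hcross : -(4 * η * g * ∑ i, dirDeriv (spaceDir i) (parabolicWeight r p) q *
        dirDeriv (spaceDir i) G q) -
      2 * ∑ i, (η * dirDeriv (spaceDir i) G q +
        g * dirDeriv (spaceDir i) (parabolicWeight r p) q) *
        (η * dirDeriv (spaceDir i) G q + g * dirDeriv (spaceDir i) (parabolicWeight r p) q) ≤
      6 * g ^ 2 * ∑ i, dirDeriv (spaceDir i) (parabolicWeight r p) q ^ 2 := by
    rw [Finset.mul_sum, Finset.mul_sum, Finset.mul_sum, ← Finset.sum_neg_distrib,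
      ← Finset.sum_sub_distrib]
    refine Finset.sum_le_sum fun i _ => ?_
    nlinarith [sq_nonneg (η * dirDeriv (spaceDir i) G q +
      2 * (g * dirDeriv (spaceDir i) (parabolicWeight r p) q))]
  rw [hsum] at hcross
  have h1 : η * g ^ 2 * (1 + 2 * (d : ℝ)) ≤ r ^ 2 * g ^ 2 * (1 + 2 * (d : ℝ)) := by gcongr
  have h2 : g ^ 2 * ‖q.2 - p.2‖ ^ 2 ≤ g ^ 2 * r ^ 2 := by gcongr
  linarith

/-- Bernstein's interior gradient estimate. -/
theorem IsHeatSolution.abs_dirDeriv_le (hU : IsOpen U) (h : IsHeatSolution U F) (hr : 0 < r)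
    (hsub : paraboloid r p ⊆ U) (hM : ∀ q ∈ paraboloid r p, |F q| ≤ M) (i : Fin d) :
    |_root_.dirDeriv (spaceDir i) F p| ≤ √(13 + 2 * d) / r * M := by
  have hM0 : 0 ≤ M := (abs_nonneg _).trans (hM p self_mem_paraboloid)
  have hG := h.dirDeriv hU (spaceDir i)
  set G := _root_.dirDeriv (spaceDir i) F with hGdef
  have hη : ContDiffOn ℝ ∞ (parabolicWeight r p) U := (contDiff_parabolicWeight r p).contDiffOn
  have hw1 := (hη.mul hG.contDiffOn).mul (hη.mul hG.contDiffOn)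
  have hFF := h.contDiffOn.mul h.contDiffOn
  set c : ℝ := (13 + 2 * d) * r ^ 2 with hc
  have hc0 : 0 ≤ c := by positivity
  have hsq : ∀ q ∈ paraboloid r p, F q * F q ≤ M ^ 2 := fun q hq => by
    rw [← sq, ← sq_abs]; exact pow_le_pow_left₀ (abs_nonneg _) (hM q hq) 2
  have hmax := le_of_heatOp_nonpos (M := c * M ^ 2) hr hU
    (hw1.add (contDiffOn_const (c := c).mul hFF)) hsub (fun q hq => by
      refine (heatOp_add hU hw1 (contDiffOn_const (c := c).mul hFF) (hsub hq)).trans_le ?_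
      have h1 := heatOp_weighted_sq_le hU hG hq (hsub hq)
      have h2 : heatOp (fun q => c * (F q * F q)) q = c * heatOp (fun q => F q * F q) q :=
        heatOp_const_mul hU c hFF (hsub hq)
      have h3 := heatOp_mul hU h.contDiffOn h.contDiffOn (hsub hq)
      rw [h.heatOp_eq_zero (hsub hq)] at h3
      have h4 : G q * G q ≤ ∑ j, _root_.dirDeriv (spaceDir j) F q *
          _root_.dirDeriv (spaceDir j) F q :=
        Finset.single_le_sum (f := fun j => _root_.dirDeriv (spaceDir j) F q *
          _root_.dirDeriv (spaceDir j) F q) (fun j _ => mul_self_nonneg _) (Finset.mem_univ i)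
      have h5 := mul_le_mul_of_nonneg_left h4 hc0
      refine (add_le_add h1 h2.le).trans ?_
      rw [h3]
      nlinarith) (fun q hq h0 => by
      have := mul_le_mul_of_nonneg_left (hsq q hq) hc0
      simpa [h0] using this)
  simp only [parabolicWeight_self] at hmax
  have hFp : 0 ≤ c * (F p * F p) := mul_nonneg hc0 (mul_self_nonneg _)
  have hkey : (r * G p) ^ 2 ≤ (13 + 2 * d) * M ^ 2 := by
    have : r ^ 2 * (r * G p) ^ 2 ≤ r ^ 2 * ((13 + 2 * d) * M ^ 2) := by
      rw [hc] at hmax hFp; linarith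
    exact le_of_mul_le_mul_left this (by positivity)
  rw [div_mul_eq_mul_div, le_div_iff₀ hr]
  refine abs_le_of_sq_le_sq' (a := |G p| * r) ?_ (by positivity) |>.2
  rw [mul_pow, mul_pow, sq_abs, Real.sq_sqrt (by positivity)]
  linarith

theorem backwardCylinder_trans {m n : ℝ} {z : ℝ × EuclideanSpace ℝ (Fin d)}
    (hq : q ∈ backwardCylinder m r p) (hz : z ∈ backwardCylinder n r q) :
    z ∈ backwardCylinder (n + m) r p := by
  obtain ⟨h1, h2, h3⟩ := hq
  obtain ⟨h4, h5, h6⟩ := hz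
  refine ⟨h4.trans h1, by linarith, ?_⟩
  have := norm_sub_le_norm_sub_add_norm_sub z.2 q.2 p.2
  linarith

theorem self_mem_backwardCylinder {n : ℝ} (hn : 0 ≤ n) (hr : 0 ≤ r) :
    p ∈ backwardCylinder n r p := by
  refine ⟨le_rfl, ?_, ?_⟩
  · have : 0 ≤ n * r ^ 2 := by positivity
    linarith
  · simpa using mul_nonneg hn hr

theorem IsHeatSolution.abs_dirDeriv_timeDir_le (hU : IsOpen U) (h : IsHeatSolution U F)
    (hr : 0 < r) (hsub : backwardCylinder 2 r p ⊆ U)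
    (hM : ∀ q ∈ backwardCylinder 2 r p, |F q| ≤ M) :
    |_root_.dirDeriv timeDir F p| ≤ d * (13 + 2 * d) / r ^ 2 * M := by
  have hnest : ∀ q ∈ paraboloid r p, ∀ z ∈ paraboloid r q, z ∈ backwardCylinder 2 r p := by
    intro q hq z hz
    have := backwardCylinder_trans (paraboloid_subset hr.le hq) (paraboloid_subset hr.le hz)
    rwa [one_add_one_eq_two] at this
  have hpU : paraboloid r p ⊆ U := fun q hq => hsub (hnest q hq q self_mem_paraboloid)
  have hi (i : Fin d) : |_root_.dirDeriv (spaceDir i) (_root_.dirDeriv (spaceDir i) F) p| ≤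
      (13 + 2 * d) / r ^ 2 * M := by
    refine ((h.dirDeriv hU (spaceDir i)).abs_dirDeriv_le hU hr hpU (fun q hq =>
      h.abs_dirDeriv_le hU hr (fun z hz => hsub (hnest q hq z hz))
        (fun z hz => hM z (hnest q hq z hz)) i) i).trans_eq ?_
    rw [← mul_assoc, div_mul_div_comm, Real.mul_self_sqrt (by positivity), ← sq]
  rw [h.eq p (hpU self_mem_paraboloid)]
  refine (Finset.abs_sum_le_sum_abs _ _).trans ((Finset.sum_le_sum fun i _ => hi i).trans_eq ?_)
  simp
  ring

theorem IsHeatSolution.abs_iterate_dirDeriv_timeDir_le (hU : IsOpen U) (hr : 0 < r) (n : ℕ)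
    (h : IsHeatSolution U F) (hsub : backwardCylinder (2 * n) r p ⊆ U)
    (hM : ∀ q ∈ backwardCylinder (2 * n) r p, |F q| ≤ M) :
    |(_root_.dirDeriv timeDir)^[n] F p| ≤ (d * (13 + 2 * d) / r ^ 2) ^ n * M := by
  induction n generalizing F M with
  | zero => simpa using hM p (self_mem_backwardCylinder (by simp) hr.le)
  | succ n ih =>
    have hnest : ∀ q ∈ backwardCylinder (2 * n) r p, ∀ z ∈ backwardCylinder 2 r q,
        z ∈ backwardCylinder (2 * (n + 1 : ℕ)) r p := fun q hq z hz => by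
      have := backwardCylinder_trans hq hz
      rwa [show (2 : ℝ) + 2 * n = 2 * (n + 1 : ℕ) by push_cast; ring] at this
    rw [Function.iterate_succ_apply, pow_succ, mul_assoc]
    refine ih (h.dirDeriv hU timeDir)
      (fun q hq => hsub (hnest q hq q (self_mem_backwardCylinder zero_le_two hr.le)))
      fun q hq => h.abs_dirDeriv_timeDir_le hU hr (fun z hz => hsub (hnest q hq z hz))
        fun z hz => hM z (hnest q hq z hz)

theorem deriv_iterate_eq (hU : IsOpen U) (n : ℕ) (hF : ContDiffOn ℝ ∞ F U)
    (x : EuclideanSpace ℝ (Fin d)) {t : ℝ} (ht : (t, x) ∈ U) :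
    deriv^[n] (fun s => F (s, x)) t = (dirDeriv timeDir)^[n] F (t, x) := by
  have hF' (n : ℕ) : ContDiffOn ℝ ∞ ((dirDeriv timeDir)^[n] F) U := by
    induction n with
    | zero => exact hF
    | succ n ih => rw [Function.iterate_succ_apply']; exact ih.dirDeriv _ hU
  induction n generalizing t with
  | zero => rfl
  | succ n ih =>
    have hmem : ∀ᶠ s : ℝ in 𝓝 t, (s, x) ∈ U :=
      (by fun_prop : Continuous fun s : ℝ => (s, x)).continuousAt.eventually (hU.mem_nhds ht)
    rw [Function.iterate_succ_apply', Function.iterate_succ_apply',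
      EventuallyEq.deriv_eq (hmem.mono fun s hs => ih hs)]
    exact (((hF' n).differentiableAt_of_isOpen hU ht).hasFDerivAt.comp_hasDerivAt t
      ((hasDerivAt_id t).prodMk (hasDerivAt_const t x))).deriv

theorem fderiv_slice (hF : DifferentiableAt ℝ F p) (i : Fin d) :
    fderiv ℝ (fun y => F (p.1, y)) p.2 (EuclideanSpace.single i 1) =
      dirDeriv (spaceDir i) F p := by
  have h : HasFDerivAt (fun y : EuclideanSpace ℝ (Fin d) => (p.1, y))
      (ContinuousLinearMap.inr ℝ ℝ (EuclideanSpace ℝ (Fin d))) p.2 :=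
    hasFDerivAt_prodMk_right p.1 p.2
  exact congrArg (fun L => L (EuclideanSpace.single i 1)) (hF.hasFDerivAt.comp p.2 h).fderiv

theorem Lap_slice (hU : IsOpen U) (hF : ContDiffOn ℝ ∞ F U) (hp : p ∈ U) :
    Lap (fun y => F (p.1, y)) p.2 =
      ∑ i, dirDeriv (spaceDir i) (dirDeriv (spaceDir i) F) p := by
  refine Finset.sum_congr rfl fun i _ => ?_
  have hmem : ∀ᶠ y in 𝓝 p.2, (p.1, y) ∈ U :=
    (by fun_prop : Continuous fun y : EuclideanSpace ℝ (Fin d) =>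
      (p.1, y)).continuousAt.eventually (hU.mem_nhds hp)
  rw [← fderiv_slice ((hF.dirDeriv _ hU).differentiableAt_of_isOpen hU hp) i]
  congr 1
  exact EventuallyEq.fderiv_eq (hmem.mono fun y hy =>
    fderiv_slice (p := (p.1, y)) (hF.differentiableAt_of_isOpen hU hy) i)

end Heat

/-- If `u` is a smooth solution of the heat equation `∂ₜu = Δu` on (a neighborhood of)
`[-2,0] × ℝ^d` with `|u(t,x)| ≤ exp(A₂ |x|²)`, then there is `A₃ > 0` depending only on
`d` and `A₂` such that `|∂ₜᵏ u(0,x₀)| ≤ A₃^{k+1} kᵏ exp(2 A₂ |x₀|²)` for every `x₀` and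
every integer `k ≥ 1`. -/
theorem heat_time_derivative_bound (d : ℕ) (A₂ : ℝ) (hA₂ : 0 < A₂) :
    ∃ A₃ > (0:ℝ),
      ∀ (u : ℝ → EuclideanSpace ℝ (Fin d) → ℝ),
      ∀ U : Set (ℝ × EuclideanSpace ℝ (Fin d)), IsOpen U →
        (Set.Icc (-2:ℝ) 0 ×ˢ (Set.univ : Set (EuclideanSpace ℝ (Fin d)))) ⊆ U →
        ContDiffOn ℝ (⊤ : ℕ∞) (fun p : ℝ × EuclideanSpace ℝ (Fin d) => u p.1 p.2) U →
        (∀ p ∈ U, deriv (fun s => u s p.2) p.1 = Lap (u p.1) p.2) →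
        (∀ t ∈ Set.Icc (-2:ℝ) 0, ∀ x, |u t x| ≤ Real.exp (A₂ * ‖x‖^2)) →
        ∀ (x₀ : EuclideanSpace ℝ (Fin d)) (k : ℕ), 1 ≤ k →
          |deriv^[k] (fun s => u s x₀) 0| ≤ A₃^(k+1) * (k:ℝ)^k * Real.exp (2 * A₂ * ‖x₀‖^2) := by
  refine ⟨d * (13 + 2 * d) * Real.exp (8 * A₂) + 1, by positivity, ?_⟩
  intro u U hU hsub hsmooth heq hbd x₀ k hk
  set F : ℝ × EuclideanSpace ℝ (Fin d) → ℝ := fun p => u p.1 p.2 with hF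
  have hsol : IsHeatSolution U F := by
    refine ⟨hsmooth, fun p hp => ?_⟩
    rw [← Lap_slice hU hsmooth hp]
    exact (deriv_iterate_eq hU 1 hsmooth p.2 hp).symm.trans (heq p hp)
  have hk0 : (0 : ℝ) < k := by exact_mod_cast hk
  set r : ℝ := (√k)⁻¹ with hr
  have hr0 : 0 < r := by positivity
  have hr2 : r ^ 2 = (k : ℝ)⁻¹ := by rw [hr, inv_pow, Real.sq_sqrt hk0.le]
  have hcyl : ∀ q ∈ backwardCylinder (2 * k) r ((0 : ℝ), x₀),
      q.1 ∈ Icc (-2 : ℝ) 0 ∧ ‖q.2‖ ^ 2 ≤ 2 * ‖x₀‖ ^ 2 + 8 * k := by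
    rintro q ⟨h1, h2, h3⟩
    have h4 : 2 * (k : ℝ) * r ^ 2 = 2 := by rw [hr2]; field_simp
    refine ⟨⟨by simp only at h2; linarith, h1⟩, ?_⟩
    have h5 : ‖q.2 - x₀‖ ^ 2 ≤ 4 * k := by
      calc ‖q.2 - x₀‖ ^ 2 ≤ (2 * k * r) ^ 2 := pow_le_pow_left₀ (norm_nonneg _) h3 2
        _ = 4 * k := by rw [mul_pow, hr2]; field_simp; norm_num
    have h6 : ‖q.2‖ ≤ ‖x₀‖ + ‖q.2 - x₀‖ := by
      simpa using norm_add_le x₀ (q.2 - x₀)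
    nlinarith [sq_nonneg (‖x₀‖ - ‖q.2 - x₀‖), norm_nonneg q.2]
  have hmain := hsol.abs_iterate_dirDeriv_timeDir_le hU hr0 k
    (M := Real.exp (2 * A₂ * ‖x₀‖ ^ 2) * Real.exp (8 * A₂) ^ k)
    (fun q hq => hsub ⟨(hcyl q hq).1, mem_univ _⟩) fun q hq => by
      refine (hbd q.1 (hcyl q hq).1 q.2).trans ?_
      rw [← Real.exp_nat_mul, ← Real.exp_add, Real.exp_le_exp]
      nlinarith [(hcyl q hq).2]
  have h0 : ((0 : ℝ), x₀) ∈ U := hsub ⟨⟨by norm_num, le_rfl⟩, mem_univ _⟩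
  rw [deriv_iterate_eq (F := F) hU k hsmooth x₀ h0]
  refine hmain.trans ?_
  rw [hr2, div_inv_eq_mul]
  set B : ℝ := d * (13 + 2 * d) * Real.exp (8 * A₂) with hB
  have hB0 : 0 ≤ B := by positivity
  calc (d * (13 + 2 * d) * k : ℝ) ^ k * (Real.exp (2 * A₂ * ‖x₀‖ ^ 2) * Real.exp (8 * A₂) ^ k)
      = B ^ k * (k : ℝ) ^ k * Real.exp (2 * A₂ * ‖x₀‖ ^ 2) := by
        rw [hB, mul_pow, mul_pow _ (Real.exp _)]; ring
    _ ≤ (B + 1) ^ (k + 1) * (k : ℝ) ^ k * Real.exp (2 * A₂ * ‖x₀‖ ^ 2) := by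
        gcongr
        calc B ^ k ≤ (B + 1) ^ k := by gcongr; linarith
          _ ≤ (B + 1) ^ (k + 1) := pow_le_pow_right₀ (by linarith) (Nat.le_succ k)
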